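/- On the finite chain Lₙ = {0,1,...,n−1} with the usual order, a collection C of subsets is the set of all blocks of some (compatible) tolerance T on Lₙ if and only if C has the form {[nᵢ, mᵢ] : i = 1,...,k} for some 1 ≤ k, with n₁ = 0, m_k = n−1, nᵢ < n_{i+1} ≤ mᵢ + 1, and mᵢ < m_{i+1} for all i < k. -/

import Mathlib

def IsPreblock {S : Type*} (T : S → S → Prop) (K : Set S) : Prop :=
  ∀ a ∈ K, ∀ b ∈ K, T a b

def IsBlock {S : Type*} (T : S → S → Prop) (B : Set S) : Prop :=
  IsPreblock T B ∧ ∀ K : Set S, IsPreblock T K → B ⊆ K → K = B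

def Compatible {L : Type*} [Lattice L] (T : L → L → Prop) : Prop :=
  ∀ a₁ b₁ a₂ b₂ : L, T a₁ b₁ → T a₂ b₂ →
    T (a₁ ⊔ a₂) (b₁ ⊔ b₂) ∧ T (a₁ ⊓ a₂) (b₁ ⊓ b₂)

/-- The points at which a function on `ℕ` exceeds all of its earlier values. -/
def IsRecord (r : ℕ → ℕ) (x : ℕ) : Prop :=
  ∀ y < x, r y < r x

lemma Monotone.eq_of_no_isRecord {r : ℕ → ℕ} (hr : Monotone r) {x y : ℕ} (hxy : x ≤ y)
    (h : ∀ z, x < z → z ≤ y → ¬ IsRecord r z) : r y = r x := by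
  induction y, hxy using Nat.le_induction with
  | base => rfl
  | succ y hxy ih =>
    have hy := ih fun z hz hzy => h z hz (by omega)
    have hrec := h (y + 1) (by omega) le_rfl
    simp only [IsRecord, not_forall, not_lt] at hrec
    obtain ⟨z, hz, hle⟩ := hrec
    exact hy ▸ le_antisymm (hle.trans (hr (by omega))) (hr (by omega))

lemma Monotone.exists_enum_isRecord {r : ℕ → ℕ} (hr : Monotone r) {n : ℕ} (hn : 0 < n)
    (hle : ∀ x < n, x ≤ r x) (hlt : ∀ x < n, r x < n) :
    ∃ k, 1 ≤ k ∧ ∃ a : ℕ → ℕ, (∀ i < k, a i < n) ∧ a 0 = 0 ∧ r (a (k - 1)) = n - 1 ∧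
      (∀ i, i + 1 < k → a i < a (i + 1) ∧ a (i + 1) ≤ r (a i) + 1 ∧ r (a i) < r (a (i + 1))) ∧
      ∀ x < n, IsRecord r x ↔ ∃ i < k, x = a i := by
  classical
  set p := IsRecord r
  have p0 : p 0 := fun y hy => absurd hy (Nat.not_lt_zero y)
  have hk : 0 < Nat.count p n := by
    simpa using Nat.count_strict_mono p0 hn
  have hlt' : ∀ i < Nat.count p n, Nat.nth p i < n := fun i hi => Nat.nth_lt_of_lt_count hi
  have hmem : ∀ i < Nat.count p n, p (Nat.nth p i) := fun i hi =>
    Nat.nth_mem i fun hf => hi.trans_le (Nat.count_le_card hf n)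
  have hcount : ∀ i < Nat.count p n, Nat.count p (Nat.nth p i) = i := fun i hi =>
    Nat.count_nth fun hf => hi.trans_le (Nat.count_le_card hf n)
  have hstep : ∀ i, i + 1 < Nat.count p n → Nat.nth p i < Nat.nth p (i + 1) := fun i hi =>
    Nat.nth_lt_nth' (Nat.lt_succ_self i) fun hf => hi.trans_le (Nat.count_le_card hf n)
  refine ⟨Nat.count p n, hk, Nat.nth p, hlt', Nat.nth_zero_of_zero p0, ?_, fun i hi => ?_,
    fun x hx => ⟨fun h => ⟨_, Nat.count_strict_mono h hx, (Nat.nth_count h).symm⟩, ?_⟩⟩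
  · have hl := hlt' (Nat.count p n - 1) (by omega)
    have hconst : r (n - 1) = r (Nat.nth p (Nat.count p n - 1)) :=
      hr.eq_of_no_isRecord (by omega) fun z hz hzn hrec => by
        have h1 := Nat.count_strict_mono (p := p) (hmem _ (by omega)) hz
        rw [hcount _ (by omega)] at h1
        have h2 := Nat.count_strict_mono (p := p) (n := n) hrec (by omega)
        omega
    have := hle (n - 1) (by omega)
    have := hlt (n - 1) (by omega)
    omega
  · have hs := hstep i hi
    have hl := hlt' (i + 1) hi
    refine ⟨hs, ?_, hmem _ hi _ hs⟩
    have hconst : r (Nat.nth p (i + 1) - 1) = r (Nat.nth p i) :=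
      hr.eq_of_no_isRecord (by omega) fun z hz hzn hrec => by
        have := Nat.le_nth_of_lt_nth_succ (p := p) (a := z) (k := i) (by omega) hrec
        omega
    have := hle (Nat.nth p (i + 1) - 1) (by omega)
    omega
  · rintro ⟨i, hi, rfl⟩
    exact hmem i hi

lemma IsBlock.nonempty {S : Type*} [Nonempty S] {T : S → S → Prop} (hT : Reflexive T)
    {B : Set S} (hB : IsBlock T B) : B.Nonempty := by
  rw [Set.nonempty_iff_ne_empty]
  rintro rfl
  obtain ⟨x⟩ := ‹Nonempty S›
  refine Set.singleton_ne_empty x (hB.2 {x} ?_ (Set.empty_subset _))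
  rintro _ rfl _ rfl
  exact hT _

section Chain

variable {L : Type*} [LinearOrder L] {T : L → L → Prop}

lemma Compatible.mono_of_le (hT : Compatible T) (hrefl : Reflexive T) {x y z w : L} (h : T x y)
    (hxz : x ≤ z) (hzw : z ≤ w) (hwy : w ≤ y) : T z w := by
  have h1 := (hT _ _ _ _ h (hrefl z)).1
  rw [sup_eq_right.2 hxz, sup_eq_left.2 (hzw.trans hwy)] at h1
  have h2 := (hT _ _ _ _ h1 (hrefl w)).2
  rwa [inf_eq_left.2 hzw, inf_eq_right.2 hwy] at h2

lemma Compatible.isPreblock_Icc (hT : Compatible T) (hrefl : Reflexive T) (hsymm : Symmetric T)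
    {x y : L} (h : T x y) : IsPreblock T (Set.Icc x y) := by
  intro u hu v hv
  rcases le_total u v with huv | huv
  · exact hT.mono_of_le hrefl h hu.1 huv hv.2
  · exact hsymm (hT.mono_of_le hrefl h hv.1 huv hu.2)

/-- Here `r x` is the largest element related to `x`. -/
lemma Compatible.monotone_greatest (hT : Compatible T) (hrefl : Reflexive T) {r : L → L}
    (hr : ∀ x, T x (r x)) (hmax : ∀ x y, T x y → y ≤ r x) : Monotone r := by
  intro x y hxy
  rcases le_total (r x) y with h | h
  · exact h.trans (hmax _ _ (hrefl y))
  · exact hmax _ _ (hT.mono_of_le hrefl (hr x) hxy h le_rfl)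

lemma Compatible.isBlock_iff [Finite L] [Nonempty L] (hT : Compatible T) (hrefl : Reflexive T)
    (hsymm : Symmetric T) {r : L → L} (hr : ∀ x, T x (r x)) (hmax : ∀ x y, T x y → y ≤ r x)
    {B : Set L} : IsBlock T B ↔ ∃ x, (∀ y < x, r y < r x) ∧ B = Set.Icc x (r x) := by
  have hmono := hT.monotone_greatest hrefl hr hmax
  constructor
  · intro hB
    obtain ⟨x, hxB, hx⟩ := Set.exists_min_image B id B.toFinite (hB.nonempty hrefl)
    have hsub : B ⊆ Set.Icc x (r x) := fun y hy => ⟨hx y hy, hmax _ _ (hB.1 x hxB y hy)⟩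
    refine ⟨x, fun y hy => ?_, (hB.2 _ (hT.isPreblock_Icc hrefl hsymm (hr x)) hsub).symm⟩
    by_contra! hle
    have heq := hB.2 _ (hT.isPreblock_Icc hrefl hsymm (hr y))
      (hsub.trans (Set.Icc_subset_Icc hy.le hle))
    have hyB : y ∈ B := heq ▸ Set.left_mem_Icc.2 (hmax _ _ (hrefl y))
    exact absurd (hx y hyB) hy.not_ge
  · rintro ⟨x, hx, rfl⟩
    refine ⟨hT.isPreblock_Icc hrefl hsymm (hr x), fun K hK hsub => hsub.antisymm' fun y hy => ?_⟩
    have hxr : x ≤ r x := hmax _ _ (hrefl x)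
    refine ⟨?_, hmax _ _ (hK x (hsub (Set.left_mem_Icc.2 hxr)) y hy)⟩
    by_contra! hlt
    exact absurd (hmax _ _ (hK y hy (r x) (hsub (Set.right_mem_Icc.2 hxr)))) (hx y hlt).not_ge

variable {ι : Type*}

/-- The relation of lying in a common interval `[a i, b i]`. -/
def CommonIcc (a b : ι → L) (x y : L) : Prop :=
  ∃ i, x ∈ Set.Icc (a i) (b i) ∧ y ∈ Set.Icc (a i) (b i)

lemma CommonIcc.symmetric (a b : ι → L) : Symmetric (CommonIcc a b) :=
  fun _ _ ⟨i, hx, hy⟩ => ⟨i, hy, hx⟩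

variable [LinearOrder ι]

lemma CommonIcc.compatible {a b : ι → L} (ha : Monotone a) (hb : Monotone b) :
    Compatible (CommonIcc a b) := by
  have key : ∀ {i j x y}, i ≤ j → x ∈ Set.Icc (a i) (b i) → y ∈ Set.Icc (a j) (b j) →
      x ⊔ y ∈ Set.Icc (a j) (b j) ∧ x ⊓ y ∈ Set.Icc (a i) (b i) := fun hij hx hy =>
    ⟨⟨hy.1.trans le_sup_right, sup_le (hx.2.trans (hb hij)) hy.2⟩,
      ⟨le_inf hx.1 ((ha hij).trans hy.1), inf_le_left.trans hx.2⟩⟩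
  rintro x₁ y₁ x₂ y₂ ⟨i, hx₁, hy₁⟩ ⟨j, hx₂, hy₂⟩
  rcases le_total i j with hij | hij
  · have h1 := key hij hx₁ hx₂
    have h2 := key hij hy₁ hy₂
    exact ⟨⟨j, h1.1, h2.1⟩, ⟨i, h1.2, h2.2⟩⟩
  · have h1 := key hij hx₂ hx₁
    have h2 := key hij hy₂ hy₁
    rw [sup_comm x₁, sup_comm y₁, inf_comm x₁, inf_comm y₁]
    exact ⟨⟨i, h1.1, h2.1⟩, ⟨j, h1.2, h2.2⟩⟩

lemma CommonIcc.isBlock_iff [Finite L] [Nonempty L] {a b : ι → L} (ha : StrictMono a)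
    (hb : StrictMono b) (hab : ∀ i, a i ≤ b i) (hrefl : Reflexive (CommonIcc a b)) {B : Set L} :
    IsBlock (CommonIcc a b) B ↔ ∃ i, B = Set.Icc (a i) (b i) := by
  have hpre : ∀ i, IsPreblock (CommonIcc a b) (Set.Icc (a i) (b i)) :=
    fun i x hx y hy => ⟨i, hx, hy⟩
  constructor
  · intro hB
    obtain ⟨x, hxB, hx⟩ := Set.exists_min_image B id B.toFinite (hB.nonempty hrefl)
    obtain ⟨y, hyB, hy⟩ := Set.exists_max_image B id B.toFinite (hB.nonempty hrefl)
    obtain ⟨i, hxi, hyi⟩ := hB.1 x hxB y hyB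
    exact ⟨i, (hB.2 _ (hpre i) fun z hz =>
      ⟨hxi.1.trans (hx z hz), (hy z hz).trans hyi.2⟩).symm⟩
  · rintro ⟨i, rfl⟩
    refine ⟨hpre i, fun K hK hsub => hsub.antisymm' fun y hy => ⟨?_, ?_⟩⟩
    · obtain ⟨j, hyj, hbj⟩ := hK y hy (b i) (hsub (Set.right_mem_Icc.2 (hab i)))
      exact (ha.monotone (hb.le_iff_le.1 hbj.2)).trans hyj.1
    · obtain ⟨j, hyj, haj⟩ := hK y hy (a i) (hsub (Set.left_mem_Icc.2 (hab i)))
      exact hyj.2.trans (hb.monotone (ha.le_iff_le.1 haj.1))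

end Chain

/-- On the finite chain `Fin n`, a collection `C` of subsets is the set of all
blocks of some compatible tolerance if and only if it consists of intervals
`[nᵢ, mᵢ]`, `i = 1, …, k`, with `n₁ = 0`, `m_k = n-1`, `nᵢ < n_{i+1} ≤ mᵢ + 1`
and `mᵢ < m_{i+1}`. -/
theorem chain_tolerance_blocks_characterization (n : ℕ) (hn : 0 < n)
    (C : Set (Set (Fin n))) :
    (∃ T : Fin n → Fin n → Prop, Reflexive T ∧ Symmetric T ∧ Compatible T ∧
      C = {B : Set (Fin n) | IsBlock T B}) ↔
    (∃ k : ℕ, 1 ≤ k ∧ ∃ a b : ℕ → ℕ,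
      (∀ i < k, a i < n ∧ b i < n) ∧
      a 0 = 0 ∧ b (k - 1) = n - 1 ∧
      (∀ i, i + 1 < k → a i < a (i + 1) ∧ a (i + 1) ≤ b i + 1 ∧ b i < b (i + 1)) ∧
      C = {s : Set (Fin n) | ∃ i < k, s = {x : Fin n | a i ≤ x.val ∧ x.val ≤ b i}}) := by
  have : Nonempty (Fin n) := ⟨⟨0, hn⟩⟩
  constructor
  · rintro ⟨T, hrefl, hsymm, hT, rfl⟩
    have hex : ∀ x, ∃ y, T x y ∧ ∀ z, T x z → z ≤ y := fun x =>
      Set.exists_max_image {y | T x y} id (Set.toFinite _) ⟨x, hrefl x⟩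
    choose r hr hmax using hex
    have hmono := hT.monotone_greatest hrefl hr hmax
    set s : ℕ → ℕ := fun x => if h : x < n then r ⟨x, h⟩ else n - 1 with hs
    have hs_val : ∀ x : Fin n, s x = r x := fun x => by simp [hs]
    have hs_mono : Monotone s := by
      intro x y hxy
      by_cases hy : y < n
      · have h : r ⟨x, hxy.trans_lt hy⟩ ≤ r ⟨y, hy⟩ := hmono hxy
        simpa [hs, hy, hxy.trans_lt hy] using h
      · simp only [hs, hy, dite_false]
        split_ifs <;> omega
    obtain ⟨k, hk, a, ha, ha0, hlast, hstep, hrec⟩ := hs_mono.exists_enum_isRecord hn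
      (fun x hx => (Fin.le_def.1 (hmax _ _ (hrefl ⟨x, hx⟩))).trans_eq (hs_val ⟨x, hx⟩).symm)
      (fun x hx => (hs_val ⟨x, hx⟩).trans_lt (r ⟨x, hx⟩).isLt)
    have hrecord : ∀ x : Fin n, (∀ y < x, r y < r x) ↔ ∃ i < k, (x : ℕ) = a i := by
      intro x
      rw [← hrec x x.isLt]
      constructor
      · intro h y hy
        have := h ⟨y, hy.trans x.isLt⟩ hy
        rwa [Fin.lt_def, ← hs_val, ← hs_val] at this
      · intro h y hy
        have := h y hy
        rwa [hs_val, hs_val] at this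
    refine ⟨k, hk, a, fun i => s (a i), fun i hi => ⟨ha i hi, ?_⟩, ha0, hlast, hstep, ?_⟩
    · exact (hs_val ⟨a i, ha i hi⟩).trans_lt (r ⟨a i, ha i hi⟩).isLt
    · ext B
      simp only [Set.mem_ofPred_eq, hT.isBlock_iff hrefl hsymm hr hmax, hrecord]
      constructor
      · rintro ⟨x, ⟨i, hi, hx⟩, rfl⟩
        refine ⟨i, hi, ?_⟩
        ext y
        simp only [← hx, hs_val, Set.mem_Icc, Set.mem_ofPred_eq, Fin.le_def]
      · rintro ⟨i, hi, rfl⟩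
        refine ⟨⟨a i, ha i hi⟩, ⟨i, hi, rfl⟩, ?_⟩
        ext y
        simp only [Set.mem_Icc, Set.mem_ofPred_eq, Fin.le_def, ← hs_val]
  · rintro ⟨k, hk, a, b, hlt, ha0, hlast, hstep, rfl⟩
    obtain ⟨k, rfl⟩ : ∃ l, k = l + 1 := ⟨k - 1, by omega⟩
    let a' : Fin (k + 1) → Fin n := fun i => ⟨a i, (hlt i i.isLt).1⟩
    let b' : Fin (k + 1) → Fin n := fun i => ⟨b i, (hlt i i.isLt).2⟩
    have ha' : StrictMono a' := Fin.strictMono_iff_lt_succ.2 fun i =>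
      (hstep i (by omega)).1
    have hb' : StrictMono b' := Fin.strictMono_iff_lt_succ.2 fun i =>
      (hstep i (by omega)).2.2
    have hab : ∀ i, a' i ≤ b' i := by
      intro i
      induction i using Fin.cases with
      | zero => exact Fin.le_def.2 (by simp [a', ha0])
      | succ i =>
        have := hstep i (by omega)
        simp only [a', b', Fin.le_def, Fin.val_succ]
        omega
    have hrefl : Reflexive (CommonIcc a' b') := by
      intro x
      have hex : ∃ i, i < k + 1 ∧ (x : ℕ) ≤ b i :=
        ⟨k, by omega, by simp only [Nat.add_sub_cancel] at hlast; omega⟩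
      classical
      obtain ⟨hi, hxb⟩ := Nat.find_spec hex
      have hmem : x ∈ Set.Icc (a' ⟨Nat.find hex, hi⟩) (b' ⟨Nat.find hex, hi⟩) := by
        refine ⟨?_, hxb⟩
        change a (Nat.find hex) ≤ x
        rcases h : Nat.find hex with _ | j
        · omega
        · have hj := Nat.find_min hex (m := j) (by omega)
          have := hstep j (by omega)
          omega
      exact ⟨_, hmem, hmem⟩
    refine ⟨CommonIcc a' b', hrefl, CommonIcc.symmetric a' b',
      CommonIcc.compatible ha'.monotone hb'.monotone, ?_⟩
    ext B
    simp only [Set.mem_ofPred_eq, CommonIcc.isBlock_iff ha' hb' hab hrefl]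
    exact ⟨fun ⟨i, hi, h⟩ => ⟨⟨i, hi⟩, h⟩, fun ⟨i, h⟩ => ⟨i, i.isLt, h⟩⟩
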